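/- If the pairs (U₁,V₁) and (U₂,V₂) of bounded linear operators on H satisfy the symplectic relations, then the pair (U₃,V₃) := (U₂U₁ + V₂V̄₁, U₂V₁ + V₂Ū₁) also satisfies the symplectic relations, and the composition of the associated real-linear maps obeys R(U₂,V₂) ∘ R(U₁,V₁) = R(U₃,V₃), i.e. U₂(U₁f + V₁(Jf)) + V₂ J(U₁f + V₁(Jf)) = U₃ f + V₃ (J f) for all f ∈ H. -/

import Mathlib

open ContinuousLinearMap
open scoped InnerProductSpace

variable {H : Type*} [NormedAddCommGroup H] [InnerProductSpace ℂ H] [CompleteSpace H]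

/-- The complex conjugate `Ā := J ∘ A ∘ J` of a bounded operator with respect to the
conjugation `J`. -/
noncomputable def conjOp (J : H →L⋆[ℂ] H) (A : H →L[ℂ] H) : H →L[ℂ] H :=
  (J.comp A).comp J

/-- The transpose `Aᵀ := J ∘ A* ∘ J` of a bounded operator with respect to the
conjugation `J`. -/
noncomputable def transp (J : H →L⋆[ℂ] H) (A : H →L[ℂ] H) : H →L[ℂ] H :=
  conjOp J (adjoint A)

/-- The pair `(U, V)` satisfies the symplectic relations:
`U U* − V V* = 1`, `U Vᵀ = V Uᵀ`, `U* U − Vᵀ V̄ = 1`, `Uᵀ V̄ = V* U`. -/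
def SymplecticPair (J : H →L⋆[ℂ] H) (U V : H →L[ℂ] H) : Prop :=
  U ∘L adjoint U - V ∘L adjoint V = 1 ∧
  U ∘L transp J V = V ∘L transp J U ∧
  adjoint U ∘L U - transp J V ∘L conjOp J V = 1 ∧
  transp J U ∘L conjOp J V = adjoint V ∘L U

/-- The symplectic relations for a pair of elements of a star ring, with respect to an
endomorphism `c` in the role of complex conjugation. -/
def StarSymplectic {R : Type*} [Ring R] [StarRing R] (c : R →+* R) (u v : R) : Prop :=
  u * star u - v * star v = 1 ∧
  u * c (star v) = v * c (star u) ∧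
  star u * u - c (star v) * c v = 1 ∧
  c (star u) * c v = star v * u

theorem StarSymplectic.comp {R : Type*} [Ring R] [StarRing R] {c : R →+* R}
    (hc : ∀ a, c (c a) = a) (hstar : ∀ a, star (c a) = c (star a)) {u₁ v₁ u₂ v₂ : R}
    (h₁ : StarSymplectic c u₁ v₁) (h₂ : StarSymplectic c u₂ v₂) :
    StarSymplectic c (u₂ * u₁ + v₂ * c v₁) (u₂ * v₁ + v₂ * c u₁) := by
  obtain ⟨e1, e2, e3, e4⟩ := h₁
  obtain ⟨f1, f2, f3, f4⟩ := h₂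
  have e1c := congrArg c e1
  have e2c := congrArg c e2
  have f3c := congrArg c f3
  have f4c := congrArg c f4
  simp only [map_sub, map_mul, map_one, hc] at e1c e2c f3c f4c
  simp only [StarSymplectic, star_add, star_mul, map_add, map_mul, hstar, hc]
  refine ⟨?_, ?_, ?_, ?_⟩
  · linear_combination (norm := noncomm_ring) u₂ * e1 * star u₂ - v₂ * e1c * star v₂
      + u₂ * e2 * star v₂ - v₂ * e2c * star u₂ + f1
  · linear_combination (norm := noncomm_ring) u₂ * e2 * c (star u₂) + u₂ * e1 * c (star v₂)
      - v₂ * e1c * c (star u₂) - v₂ * e2c * c (star v₂) + f2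
  · linear_combination (norm := noncomm_ring) star u₁ * f3 * u₁ - c (star v₁) * f3c * c v₁
      + star u₁ * f4c * c v₁ - c (star v₁) * f4 * u₁ + e3
  · linear_combination (norm := noncomm_ring) c (star u₁) * f4 * u₁
      + c (star u₁) * f3c * c v₁ - star v₁ * f3 * u₁ - star v₁ * f4c * c v₁ + e4

theorem inner_conjugation_conjugation {E : Type*} [NormedAddCommGroup E] [InnerProductSpace ℂ E]
    {J : E →L⋆[ℂ] E} (hJnorm : ∀ x, ‖J x‖ = ‖x‖) (x y : E) :
    ⟪J x, J y⟫_ℂ = ⟪y, x⟫_ℂ := by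
  have hsub : J x - Complex.I • J y = J (x + Complex.I • y) := by
    simp [map_smulₛₗ, sub_eq_add_neg]
  have hadd : J x + Complex.I • J y = J (x - Complex.I • y) := by
    simp [map_smulₛₗ]
  rw [← inner_conj_symm y x, inner_eq_sum_norm_sq_div_four (J x),
    inner_eq_sum_norm_sq_div_four x y]
  have hfour : (starRingEnd ℂ) 4 = 4 := Complex.conj_ofNat 4
  simp only [RCLike.I_to_complex, hsub, hadd, ← map_add, ← map_sub, hJnorm]
  simp [hfour]
  ring

theorem adjoint_conjOp {J : H →L⋆[ℂ] H} (hJinv : ∀ x, J (J x) = x) (hJnorm : ∀ x, ‖J x‖ = ‖x‖)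
    (A : H →L[ℂ] H) : adjoint (conjOp J A) = conjOp J (adjoint A) := by
  symm
  rw [eq_adjoint_iff]
  intro x y
  calc ⟪J (adjoint A (J x)), y⟫_ℂ = ⟪J (adjoint A (J x)), J (J y)⟫_ℂ := by rw [hJinv]
    _ = ⟪A (J y), J x⟫_ℂ := by
      rw [inner_conjugation_conjugation hJnorm, adjoint_inner_right]
    _ = ⟪J (J x), J (A (J y))⟫_ℂ := (inner_conjugation_conjugation hJnorm _ _).symm
    _ = ⟪x, J (A (J y))⟫_ℂ := by rw [hJinv]

/-- Complex conjugation of bounded operators as a ring endomorphism. -/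
noncomputable def conjOpHom (J : H →L⋆[ℂ] H) (hJinv : ∀ x, J (J x) = x) :
    (H →L[ℂ] H) →+* (H →L[ℂ] H) where
  toFun := conjOp J
  map_one' := by ext x; simp [conjOp, hJinv]
  map_mul' A B := by ext x; simp [conjOp, hJinv]
  map_zero' := by ext x; simp [conjOp]
  map_add' A B := by ext x; simp [conjOp]

/-- If `(U₁,V₁)` and `(U₂,V₂)` satisfy the symplectic relations, so does
`(U₃,V₃) := (U₂U₁ + V₂V̄₁, U₂V₁ + V₂Ū₁)`, and `R(U₂,V₂) ∘ R(U₁,V₁) = R(U₃,V₃)`. -/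
theorem statement2 (J : H →L⋆[ℂ] H) (hJinv : ∀ x, J (J x) = x) (hJnorm : ∀ x, ‖J x‖ = ‖x‖)
    (U₁ V₁ U₂ V₂ : H →L[ℂ] H)
    (h1 : SymplecticPair J U₁ V₁) (h2 : SymplecticPair J U₂ V₂) :
    SymplecticPair J (U₂ ∘L U₁ + V₂ ∘L conjOp J V₁) (U₂ ∘L V₁ + V₂ ∘L conjOp J U₁) ∧
    ∀ f : H, U₂ (U₁ f + V₁ (J f)) + V₂ (J (U₁ f + V₁ (J f)))
      = (U₂ ∘L U₁ + V₂ ∘L conjOp J V₁) f + (U₂ ∘L V₁ + V₂ ∘L conjOp J U₁) (J f) := by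
  refine ⟨StarSymplectic.comp (c := conjOpHom J hJinv) (fun A => ?_)
    (adjoint_conjOp hJinv hJnorm) h1 h2, fun f => ?_⟩
  · ext x
    simp [conjOpHom, conjOp, hJinv]
  · simp [conjOp, hJinv]
    abel
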